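/- Let X be a locally compact, connected, locally connected Hausdorff space. Suppose D ⊆ U where D is compact and U is open with compact closure. Let V be the union of the bounded connected components of X ∖ D, let B be the union of the bounded connected components of X ∖ U, and set C = V ∩ B. Then C is compact, C is disjoint from U, and U ∪ C is open. -/

import Mathlib

open Set

/-- `C` is a connected component of the set `S` (in the ambient space `X`). -/
def IsCompOf {X : Type*} [TopologicalSpace X] (C S : Set X) : Prop :=
  ∃ x ∈ S, C = connectedComponentIn S x

theorem IsPreconnected.inter_frontier_nonempty_of_isOpen {X : Type*} [TopologicalSpace X]
    {E U : Set X} (hE : IsPreconnected E) (hU : IsOpen U) (hEU : (E ∩ U).Nonempty)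
    (hne : (E \ U).Nonempty) : (E ∩ frontier U).Nonempty := by
  by_contra h
  have hcl : ∀ y ∈ E, y ∉ U → y ∉ closure U := fun y hy hyU hyc =>
    h ⟨y, hy, hU.frontier_eq ▸ ⟨hyc, hyU⟩⟩
  obtain ⟨z, hz, hzU⟩ := hne
  obtain ⟨w, -, hwU, hwc⟩ := hE U (closure U)ᶜ hU isClosed_closure.isOpen_compl
    (fun y hy => or_iff_not_imp_left.2 (hcl y hy)) hEU ⟨z, hz, hcl z hz hzU⟩
  exact hwc (subset_closure hwU)

theorem closure_connectedComponentIn_inter_subset {X : Type*} [TopologicalSpace X]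
    {F : Set X} {x : X} (hx : x ∈ F) :
    closure (connectedComponentIn F x) ∩ F ⊆ connectedComponentIn F x := by
  have hpre : IsPreconnected (closure (connectedComponentIn F x) ∩ F) :=
    isPreconnected_connectedComponentIn.subset_closure
      (subset_inter subset_closure (connectedComponentIn_subset F x)) inter_subset_left
  exact hpre.subset_connectedComponentIn
    ⟨subset_closure (mem_connectedComponentIn hx), hx⟩ inter_subset_right

theorem connectedComponentIn_compl_diff_eq_closure_diff {X : Type*} [TopologicalSpace X]
    {D U : Set X} (hDU : D ⊆ U) {x : X} (hx : x ∈ Dᶜ) :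
    connectedComponentIn Dᶜ x \ U = closure (connectedComponentIn Dᶜ x) \ U :=
  Subset.antisymm (sdiff_subset_sdiff_left subset_closure) fun _ hy =>
    ⟨closure_connectedComponentIn_inter_subset hx ⟨hy.1, fun h => hy.2 (hDU h)⟩, hy.2⟩

/-- A component of the complement of `D` that leaves an open neighbourhood `U` of `D` is the whole
space or crosses the frontier of `U`. -/
theorem eq_univ_or_inter_frontier_nonempty {X : Type*} [TopologicalSpace X] [ConnectedSpace X]
    [LocallyConnectedSpace X] {D U : Set X} (hD : IsClosed D) (hU : IsOpen U) (hDU : D ⊆ U)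
    {x : X} (hx : x ∈ Dᶜ) (hne : (connectedComponentIn Dᶜ x \ U).Nonempty) :
    connectedComponentIn Dᶜ x = univ ∨ (connectedComponentIn Dᶜ x ∩ frontier U).Nonempty := by
  by_cases hEU : (connectedComponentIn Dᶜ x ∩ U).Nonempty
  · exact .inr (isPreconnected_connectedComponentIn.inter_frontier_nonempty_of_isOpen hU hEU hne)
  · have hdisj : Disjoint (connectedComponentIn Dᶜ x) U :=
      disjoint_iff_inter_eq_empty.2 (not_nonempty_iff_eq_empty.1 hEU)
    have hclosed : IsClosed (connectedComponentIn Dᶜ x) := by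
      have h := connectedComponentIn_compl_diff_eq_closure_diff hDU hx
      rw [hdisj.sdiff_eq_left, (hdisj.closure_left hU).sdiff_eq_left] at h
      exact h ▸ isClosed_closure
    exact .inl (IsClopen.eq_univ ⟨hclosed, hD.isOpen_compl.connectedComponentIn⟩
      (hne.mono sdiff_subset))

theorem finite_components_compl_not_subset {X : Type*} [TopologicalSpace X] [ConnectedSpace X]
    [LocallyConnectedSpace X] {D U : Set X} (hD : IsClosed D) (hU : IsOpen U)
    (hUb : IsCompact (closure U)) (hDU : D ⊆ U) :
    {E : Set X | IsCompOf E Dᶜ ∧ (E \ U).Nonempty}.Finite := by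
  have hfr : frontier U ⊆ Dᶜ := fun y hy hyD => (hU.frontier_eq ▸ hy).2 (hDU hyD)
  obtain ⟨t, -, ht⟩ := (hUb.of_isClosed_subset isClosed_frontier
    frontier_subset_closure).elim_nhds_subcover (connectedComponentIn Dᶜ) fun y hy =>
      hD.isOpen_compl.connectedComponentIn.mem_nhds (mem_connectedComponentIn (hfr hy))
  refine ((t.finite_toSet.image (connectedComponentIn Dᶜ)).insert univ).subset ?_
  rintro _ ⟨⟨x, hx, rfl⟩, hne⟩
  obtain h | ⟨y, hyE, hyU⟩ := eq_univ_or_inter_frontier_nonempty hD hU hDU hx hne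
  · exact .inl h
  · obtain ⟨z, hz, hyz⟩ := mem_iUnion₂.1 (ht hyU)
    exact .inr ⟨z, hz, (connectedComponentIn_eq hyz).trans (connectedComponentIn_eq hyE).symm⟩

/-- Let `X` be a locally compact, connected, locally connected Hausdorff space, `D ⊆ U` with
`D` compact and `U` open with compact closure. Let `V` be the union of the bounded components
of `X \ D` and `B` the union of the bounded components of `X \ U`, and `C = V ∩ B`. Then `C`
is compact, `C` is disjoint from `U`, and `U ∪ C` is open. -/
theorem clever_set_compact_and_union_open
    {X : Type*} [TopologicalSpace X] [LocallyCompactSpace X] [ConnectedSpace X]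
    [LocallyConnectedSpace X] [T2Space X] (D U V B : Set X)
    (hD : IsCompact D) (hU : IsOpen U) (hUb : IsCompact (closure U)) (hDU : D ⊆ U)
    (hV : V = ⋃₀ {C : Set X | IsCompOf C Dᶜ ∧ IsCompact (closure C)})
    (hB : B = ⋃₀ {C : Set X | IsCompOf C Uᶜ ∧ IsCompact (closure C)}) :
    IsCompact (V ∩ B) ∧ Disjoint U (V ∩ B) ∧ IsOpen (U ∪ V ∩ B) := by
  have hC : V ∩ B = V \ U := by
    subst hV hB
    ext y
    constructor
    · rintro ⟨hyV, _, ⟨⟨x, -, rfl⟩, -⟩, hy⟩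
      exact ⟨hyV, connectedComponentIn_subset _ _ hy⟩
    · rintro ⟨⟨_, ⟨⟨x, hx, rfl⟩, hb⟩, hy⟩, hyU⟩
      refine ⟨⟨_, ⟨⟨x, hx, rfl⟩, hb⟩, hy⟩, _, ⟨⟨y, hyU, rfl⟩, ?_⟩, mem_connectedComponentIn hyU⟩
      refine hb.of_isClosed_subset isClosed_closure (closure_mono ?_)
      rw [connectedComponentIn_eq hy]
      exact connectedComponentIn_mono y (compl_subset_compl.2 hDU)
  have hVo : IsOpen V := by
    rw [hV]
    refine isOpen_sUnion ?_
    rintro _ ⟨⟨x, -, rfl⟩, -⟩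
    exact hD.isClosed.isOpen_compl.connectedComponentIn
  rw [hC, union_sdiff_self]
  refine ⟨?_, disjoint_sdiff_right, hU.union hVo⟩
  have hfin : {E : Set X | (IsCompOf E Dᶜ ∧ (E \ U).Nonempty) ∧ IsCompact (closure E)}.Finite :=
    (finite_components_compl_not_subset hD.isClosed hU hUb hDU).subset fun _ h => h.1
  have hVU : V \ U =
      ⋃ E ∈ {E : Set X | (IsCompOf E Dᶜ ∧ (E \ U).Nonempty) ∧ IsCompact (closure E)}, E \ U := by
    subst hV
    ext y
    simp only [mem_iUnion₂]
    constructor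
    · rintro ⟨⟨E, ⟨hE, hb⟩, hy⟩, hyU⟩
      exact ⟨E, ⟨⟨hE, y, hy, hyU⟩, hb⟩, hy, hyU⟩
    · rintro ⟨E, ⟨⟨hE, -⟩, hb⟩, hy, hyU⟩
      exact ⟨⟨E, ⟨hE, hb⟩, hy⟩, hyU⟩
  rw [hVU]
  refine hfin.isCompact_biUnion ?_
  rintro _ ⟨⟨⟨x, hx, rfl⟩, -⟩, hb⟩
  rw [connectedComponentIn_compl_diff_eq_closure_diff hDU hx]
  exact hb.diff hU
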